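/- arXiv:0803.1269 — 10 statements merged into one kernel-verified Lean document; each statement's English description precedes it below -/
import Mathlib

section
/- For every complex number s with s ∉ {0, 1/2, 1}, the rank two zeta function of ℚ, defined by ξ_{ℚ,2}(s) = ξ(2s)/(s−1) − ξ(2s−1)/s, satisfies the functional equation ξ_{ℚ,2}(1−s) = ξ_{ℚ,2}(s). -/
open Complex

/-- Weng's rank two zeta function for `ℚ`:
`ξ_{ℚ,2}(s) = ξ(2s)/(s−1) − ξ(2s−1)/s`, where `ξ` is the completed Riemann zeta. -/
noncomputable def xiQ2 (s : ℂ) : ℂ :=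
  completedRiemannZeta (2 * s) / (s - 1) - completedRiemannZeta (2 * s - 1) / s

/-- Functional equation of the rank two zeta: `ξ_{ℚ,2}(1−s) = ξ_{ℚ,2}(s)`. -/
theorem xiQ2_functional_equation (s : ℂ) (hs : s ∉ ({0, 1/2, 1} : Set ℂ)) :
    xiQ2 (1 - s) = xiQ2 s := by
  have h₁ : completedRiemannZeta (2 * (1 - s)) = completedRiemannZeta (2 * s - 1) := by
    rw [← completedRiemannZeta_one_sub]
    congr 1
    ring
  have h₂ : completedRiemannZeta (2 * (1 - s) - 1) = completedRiemannZeta (2 * s) := by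
    rw [← completedRiemannZeta_one_sub]
    congr 1
    ring
  rw [xiQ2, xiQ2, h₁, h₂, show 1 - s - 1 = -s by ring, ← neg_sub s 1, div_neg, div_neg]
  ring
end

section
/- Every zero of the rank two zeta function lies on the central line: for every complex number s with s ∉ {0, 1/2, 1}, if ξ(2s)/(s−1) − ξ(2s−1)/s = 0 then Re s = 1/2. -/
open Complex

open Set MeasureTheory Filter Topology

/-- The fractional part on `(1, ∞)`, extended by zero. -/
noncomputable def fractTail : ℝ → ℂ := (Ioi (1 : ℝ)).indicator fun t ↦ ((Int.fract t : ℝ) : ℂ)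

lemma measurable_fractTail : Measurable fractTail :=
  (measurable_ofReal.comp measurable_fract).indicator measurableSet_Ioi

lemma norm_fractTail_le (t : ℝ) : ‖fractTail t‖ ≤ 1 := by
  unfold fractTail
  by_cases ht : t ∈ Ioi (1 : ℝ)
  · rw [indicator_of_mem ht, norm_real, Real.norm_eq_abs, abs_of_nonneg (Int.fract_nonneg t)]
    exact (Int.fract_lt_one t).le
  · simp [indicator_of_notMem ht]

lemma differentiableAt_mellin_fractTail {s : ℂ} (hs : s.re < 0) :
    DifferentiableAt ℂ (mellin fractTail) s := by
  refine mellin_differentiableAt_of_isBigO_rpow (a := 0) (b := s.re - 1) ?_ ?_ hs ?_ (by simp)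
  · refine LocallyIntegrable.locallyIntegrableOn ?_ _
    exact (locallyIntegrable_const (1 : ℝ)).mono measurable_fractTail.aestronglyMeasurable
      (.of_forall fun t ↦ by simpa using norm_fractTail_le t)
  · refine Asymptotics.IsBigO.of_bound 1 (.of_forall fun t ↦ ?_)
    simpa using norm_fractTail_le t
  · refine Asymptotics.IsBigO.of_bound 1 ?_
    have : ∀ᶠ t : ℝ in 𝓝[>] 0, t < 1 := nhdsWithin_le_nhds (eventually_lt_nhds one_pos)
    filter_upwards [this] with t ht
    simp [fractTail, ht.le]

lemma mellin_fractTail (s : ℂ) :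
    mellin fractTail s = ∫ t in Ioi (1 : ℝ), (t : ℂ) ^ (s - 1) * ((Int.fract t : ℝ) : ℂ) := by
  have h : ∀ t : ℝ, (t : ℂ) ^ (s - 1) • fractTail t =
      (Ioi (1 : ℝ)).indicator (fun t : ℝ ↦ (t : ℂ) ^ (s - 1) * ((Int.fract t : ℝ) : ℂ)) t := by
    intro t
    by_cases ht : t ∈ Ioi (1 : ℝ) <;> simp [fractTail, ht]
  simp_rw [mellin, h]
  rw [setIntegral_indicator measurableSet_Ioi, Ioi_inter_Ioi]
  simp

lemma norm_mellin_fractTail_neg_le {s : ℂ} (hs : 0 < s.re) :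
    ‖mellin fractTail (-s)‖ ≤ 1 / s.re := by
  have hI : ∫ t in Ioi (1 : ℝ), t ^ (-s.re - 1) = 1 / s.re := by
    rw [integral_Ioi_rpow_of_lt (by linarith) one_pos]
    simp [neg_div_neg_eq]
  rw [mellin_fractTail, ← hI]
  refine norm_integral_le_of_norm_le (integrableOn_Ioi_rpow_of_lt (by linarith) one_pos) ?_
  filter_upwards [ae_restrict_mem measurableSet_Ioi] with t ht
  have ht0 : 0 < t := one_pos.trans ht
  rw [norm_mul, norm_cpow_eq_rpow_re_of_pos ht0, norm_real, Real.norm_eq_abs,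
    abs_of_nonneg (Int.fract_nonneg t)]
  simpa using mul_le_of_le_one_right (Real.rpow_nonneg ht0.le _) (Int.fract_lt_one t).le

lemma riemannZeta₁_eq_of_one_lt_re {s : ℂ} (hs : 1 < s.re) :
    riemannZeta₁ s = s * (1 - (s - 1) * mellin fractTail (-s)) := by
  have hs1 : s ≠ 1 := by rintro rfl; simp at hs
  have hs1' : s - 1 ≠ 0 := sub_ne_zero.mpr hs1
  have hL : riemannZeta s =
      s * ∫ t in Ioi (1 : ℝ), ((⌊t⌋₊ : ℕ) : ℂ) * (t : ℂ) ^ (-(s + 1)) := by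
    rw [← LSeries_one_eq_riemannZeta hs, LSeries_eq_mul_integral 1 zero_le_one hs
      (LSeriesSummable_one_iff.mpr hs)]
    · simp
    · refine Asymptotics.IsBigO.of_bound 1 (.of_forall fun n ↦ ?_)
      simp
  have hfl : ∀ t ∈ Ioi (1 : ℝ), ((⌊t⌋₊ : ℕ) : ℂ) * (t : ℂ) ^ (-(s + 1)) =
      (t : ℂ) ^ (-s) - (t : ℂ) ^ (-s - 1) * ((Int.fract t : ℝ) : ℂ) := by
    intro t ht
    have ht0 : (0 : ℝ) < t := one_pos.trans ht
    have ht0' : (t : ℂ) ≠ 0 := ofReal_ne_zero.mpr ht0.ne'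
    have h1 : ((⌊t⌋₊ : ℕ) : ℂ) = (t : ℂ) - ((Int.fract t : ℝ) : ℂ) := by
      rw [← ofReal_sub, Int.self_sub_fract, ← natCast_floor_eq_intCast_floor ht0.le]
      simp
    rw [h1, show -(s + 1) = -s - 1 by ring, cpow_sub _ _ ht0', cpow_one]
    field_simp
  have hi1 : IntegrableOn (fun t : ℝ ↦ (t : ℂ) ^ (-s)) (Ioi 1) :=
    integrableOn_Ioi_cpow_of_lt (by simpa using hs) one_pos
  have hi2 : IntegrableOn (fun t : ℝ ↦ (t : ℂ) ^ (-s - 1) * ((Int.fract t : ℝ) : ℂ)) (Ioi 1) := by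
    refine (integrableOn_Ioi_cpow_of_lt (a := -s - 1) (by simp; linarith) one_pos).mul_bdd (c := 1)
      (measurable_ofReal.comp measurable_fract).aestronglyMeasurable (.of_forall fun t ↦ ?_)
    rw [norm_real, Real.norm_eq_abs, abs_of_nonneg (Int.fract_nonneg t)]
    exact (Int.fract_lt_one t).le
  rw [setIntegral_congr_fun measurableSet_Ioi hfl, integral_sub hi1 hi2,
    integral_Ioi_cpow_of_lt (by simpa using hs) one_pos, ← mellin_fractTail] at hL
  have h1 := riemannZeta_eq_inv_sub_mul hs1
  have h2 : riemannZeta₁ s = (s - 1) * riemannZeta s := by rw [h1]; field_simp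
  rw [h2, hL]
  have : -s + 1 ≠ 0 := by rwa [neg_add_eq_sub, ← neg_sub, neg_ne_zero]
  simp
  field_simp
  ring

lemma riemannZeta₁_eq_of_re_pos {s : ℂ} (hs : 0 < s.re) :
    riemannZeta₁ s = s * (1 - (s - 1) * mellin fractTail (-s)) := by
  have hopen : IsOpen {z : ℂ | 0 < z.re} := isOpen_lt continuous_const continuous_re
  have hpre : IsPreconnected {z : ℂ | 0 < z.re} := (convex_halfSpace_re_gt 0).isPreconnected
  have hf : AnalyticOnNhd ℂ riemannZeta₁ {z : ℂ | 0 < z.re} :=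
    differentiable_riemannZeta₁.differentiableOn.analyticOnNhd hopen
  have hg : AnalyticOnNhd ℂ (fun s ↦ s * (1 - (s - 1) * mellin fractTail (-s)))
      {z : ℂ | 0 < z.re} := by
    refine DifferentiableOn.analyticOnNhd (fun z hz ↦ ?_) hopen
    have hM : DifferentiableAt ℂ (fun z ↦ mellin fractTail (-z)) z :=
      (differentiableAt_mellin_fractTail (s := -z) (by simpa using hz)).comp (f := Neg.neg) z
        differentiableAt_id.neg
    exact DifferentiableAt.differentiableWithinAt (by fun_prop)
  refine hf.eqOn_of_preconnected_of_eventuallyEq hg hpre (z₀ := 2) (by simp) ?_ hs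
  filter_upwards [(isOpen_lt continuous_const continuous_re).mem_nhds
    (show (1 : ℝ) < (2 : ℂ).re by simp)] with z hz
  exact riemannZeta₁_eq_of_one_lt_re hz

lemma norm_riemannZeta₁_le {s : ℂ} (hs : 0 < s.re) :
    ‖riemannZeta₁ s‖ ≤ ‖s‖ * (1 + ‖s - 1‖ / s.re) := by
  rw [riemannZeta₁_eq_of_re_pos hs, norm_mul]
  gcongr
  refine (norm_sub_le _ _).trans ?_
  rw [norm_one, norm_mul, div_eq_mul_one_div]
  gcongr
  exact norm_mellin_fractTail_neg_le hs

lemma norm_inv_riemannZeta_le {s : ℂ} (hs : 1 < s.re) :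
    ‖(riemannZeta s)⁻¹‖ ≤ 2 * s.re / (s.re - 1) := by
  have hre : 1 < ((s.re : ℝ) : ℂ).re := by simpa
  have hinv : (riemannZeta s)⁻¹ = LSeries (fun n ↦ (ArithmeticFunction.moebius n : ℂ)) s := by
    rw [← LSeries_one_eq_riemannZeta hs]
    exact inv_eq_of_mul_eq_one_right (LSeries_one_mul_Lseries_moebius hs)
  have hle : ‖(riemannZeta s)⁻¹‖ ≤ ‖riemannZeta (s.re : ℝ)‖ := by
    rw [hinv]
    have hterm : ∀ n, ‖LSeries.term (fun n ↦ (ArithmeticFunction.moebius n : ℂ)) s n‖ ≤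
        (LSeries.term 1 ((s.re : ℝ) : ℂ) n).re := by
      intro n
      rcases eq_or_ne n 0 with rfl | hn
      · simp
      · rw [LSeries.norm_term_eq, if_neg hn, LSeries.term_of_ne_zero hn, Pi.one_apply,
          ← ofReal_natCast, ← ofReal_cpow (Nat.cast_nonneg n), ← ofReal_one, ← ofReal_div, ofReal_re]
        gcongr
        norm_cast
        exact ArithmeticFunction.abs_moebius_le_one
    have hsum := LSeriesSummable_one_iff.mpr hre
    have hsum' : Summable fun n ↦ (LSeries.term 1 ((s.re : ℝ) : ℂ) n).re :=
      (hasSum_re hsum.hasSum).summable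
    refine (tsum_of_norm_bounded hsum'.hasSum hterm).trans ?_
    rw [← re_tsum hsum]
    refine (re_le_norm _).trans ?_
    rw [← LSeries_one_eq_riemannZeta hre]
    rfl
  have hpos : 0 < s.re - 1 := by linarith
  have h1 : ((s.re : ℝ) : ℂ) ≠ 1 := by rintro h; simp [h] at hre
  have hb := norm_riemannZeta₁_le (s := ((s.re : ℝ) : ℂ)) (by simp; linarith)
  refine hle.trans ?_
  rw [riemannZeta_eq_inv_sub_mul h1]
  have hn : ‖((s.re : ℝ) : ℂ) - 1‖ = s.re - 1 := by
    rw [← ofReal_one, ← ofReal_sub, norm_real, Real.norm_of_nonneg hpos.le]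
  have hn' : ‖((s.re : ℝ) : ℂ)‖ = s.re := by
    rw [norm_real, Real.norm_of_nonneg (by linarith)]
  rw [hn, hn', ofReal_re] at hb
  rw [inv_mul_eq_div, norm_div, hn]
  gcongr
  refine hb.trans ?_
  have : (s.re - 1) / s.re ≤ 1 := (div_le_one (by linarith)).mpr (by linarith)
  nlinarith

lemma norm_betaIntegral_one_half_le {z : ℂ} (hz : 1 ≤ z.re) : ‖betaIntegral z (1 / 2)‖ ≤ 2 := by
  have hre : ((1 : ℂ) / 2).re = 1 / 2 := by norm_num
  have hB : IntervalIntegrable (fun x : ℝ ↦ (1 - x) ^ (-(1 / 2) : ℝ)) volume 0 1 := by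
    have := (intervalIntegral.intervalIntegrable_rpow' (a := 0) (b := 1)
      (r := -(1 / 2)) (by norm_num)).comp_sub_left 1
    simpa using this.symm
  have hI : ∫ x in (0 : ℝ)..1, (1 - x) ^ (-(1 / 2) : ℝ) = 2 := by
    rw [intervalIntegral.integral_comp_sub_left (fun x : ℝ ↦ x ^ (-(1 / 2) : ℝ)) 1,
      integral_rpow (Or.inl (by norm_num))]
    norm_num
  rw [← hI, betaIntegral]
  refine intervalIntegral.norm_integral_le_of_norm_le zero_le_one ?_ hB
  have h1 : ∀ᵐ x : ℝ, x ≠ 1 := by simp [ae_iff, measure_singleton]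
  filter_upwards [h1] with x hx1 hx
  have hx' : 0 < 1 - x := by
    have := lt_of_le_of_ne hx.2 hx1
    linarith
  rw [norm_mul, norm_cpow_eq_rpow_re_of_pos hx.1, ← ofReal_one, ← ofReal_sub,
    norm_cpow_eq_rpow_re_of_pos hx']
  have h2 : x ^ (z - ((1 : ℝ) : ℂ)).re ≤ 1 :=
    Real.rpow_le_one hx.1.le hx.2 (by simpa using hz)
  have h3 : ((((1 : ℝ) : ℂ) / 2) - ((1 : ℝ) : ℂ)).re = -(1 / 2) := by norm_num
  rw [h3]
  exact mul_le_of_le_one_left (Real.rpow_nonneg hx'.le _) h2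

lemma Gammaℝ_eq_betaIntegral_mul {z : ℂ} (hz : 0 < z.re) :
    Gammaℝ z = betaIntegral (z / 2) (1 / 2) * Gammaℝ (z + 1) := by
  have hπ : (Real.pi : ℂ) ≠ 0 := ofReal_ne_zero.mpr Real.pi_ne_zero
  have hπ' : (Real.pi : ℂ) ^ ((1 : ℂ) / 2) ≠ 0 := by simp [cpow_eq_zero_iff, hπ]
  have h := Gamma_mul_Gamma_eq_betaIntegral (s := z / 2) (t := 1 / 2)
    (by simpa using hz) (by norm_num)
  rw [Gamma_one_half_eq] at h
  rw [Gammaℝ_def, Gammaℝ_def, eq_div_of_mul_eq hπ' h,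
    show -(z + 1) / 2 = -z / 2 - 1 / 2 by ring, cpow_sub _ _ hπ, add_div]
  field_simp

/-- The entire function `z (z - 1) Λ(z)`. -/
noncomputable def entireXi (z : ℂ) : ℂ := z * (z - 1) * completedRiemannZeta₀ z + 1

lemma differentiable_entireXi : Differentiable ℂ entireXi := by
  have := differentiable_completedZeta₀
  unfold entireXi
  fun_prop

lemma entireXi_one_sub (z : ℂ) : entireXi (1 - z) = entireXi z := by
  rw [entireXi, entireXi, completedRiemannZeta₀_one_sub]
  ring

lemma entireXi_one : entireXi 1 = 1 := by simp [entireXi]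

lemma entireXi_eq {z : ℂ} (h0 : z ≠ 0) (h1 : z ≠ 1) :
    entireXi z = z * (z - 1) * completedRiemannZeta z := by
  have : 1 - z ≠ 0 := sub_ne_zero.mpr h1.symm
  rw [entireXi, completedRiemannZeta_eq]
  field_simp
  ring

lemma entireXi_eq_Gammaℝ_mul {z : ℂ} (hz : 0 < z.re) :
    entireXi z = z * Gammaℝ z * riemannZeta₁ z := by
  rcases eq_or_ne z 1 with rfl | h1
  · simp [entireXi_one]
  have h0 : z ≠ 0 := ne_zero_of_re_pos hz
  have hG := Gammaℝ_ne_zero_of_re_pos hz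
  have h1' : z - 1 ≠ 0 := sub_ne_zero.mpr h1
  have h := riemannZeta_def_of_ne_zero h0
  rw [riemannZeta_eq_inv_sub_mul h1] at h
  rw [entireXi_eq h0 h1]
  field_simp at h
  rw [mul_assoc, mul_assoc, ← h]
  ring

lemma entireXi_ne_zero {z : ℂ} (hz : 1 ≤ z.re) : entireXi z ≠ 0 := by
  have hz0 : 0 < z.re := by linarith
  rcases eq_or_ne z 1 with rfl | h1
  · simp [entireXi_one]
  rw [entireXi_eq_Gammaℝ_mul hz0]
  refine mul_ne_zero (mul_ne_zero (ne_zero_of_re_pos hz0) (Gammaℝ_ne_zero_of_re_pos hz0)) ?_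
  have := riemannZeta_ne_zero_of_one_le_re hz
  rw [riemannZeta_eq_inv_sub_mul h1] at this
  exact right_ne_zero_of_mul this

lemma entireXi_conj {z : ℂ} (hz : 0 < z.re) :
    entireXi (starRingEnd ℂ z) = starRingEnd ℂ (entireXi z) := by
  rcases eq_or_ne z 1 with rfl | h1
  · simp [entireXi_one]
  have h1' : starRingEnd ℂ z ≠ 1 := by
    intro h
    apply h1
    simpa using congrArg (starRingEnd ℂ) h
  have hζ : ∀ w : ℂ, w ≠ 1 → riemannZeta₁ w = (w - 1) * riemannZeta w := by
    intro w hw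
    rw [riemannZeta_eq_inv_sub_mul hw, mul_inv_cancel_left₀ (sub_ne_zero.mpr hw)]
  have hG : Gammaℝ (starRingEnd ℂ z) = starRingEnd ℂ (Gammaℝ z) := by
    have harg : (Real.pi : ℂ).arg ≠ Real.pi := by
      rw [arg_ofReal_of_nonneg Real.pi_pos.le]
      exact Real.pi_ne_zero.symm
    have h2 : starRingEnd ℂ z / 2 = starRingEnd ℂ (z / 2) := by simp [map_ofNat]
    have h3 : -starRingEnd ℂ z / 2 = starRingEnd ℂ (-z / 2) := by simp [map_ofNat]
    rw [Gammaℝ_def, Gammaℝ_def, map_mul, h2, h3, Gamma_conj, cpow_conj _ _ harg, conj_ofReal]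
  rw [entireXi_eq_Gammaℝ_mul (by simpa using hz), entireXi_eq_Gammaℝ_mul hz, hζ _ h1', hζ _ h1,
    riemannZeta_conj, hG]
  simp

lemma norm_entireXi_add_one_of_re_eq_zero (y : ℝ) :
    ‖entireXi (y * I + 1)‖ = ‖entireXi (y * I)‖ := by
  rw [← entireXi_one_sub (y * I), ← norm_conj (entireXi (y * I + 1)),
    ← entireXi_conj (by simp)]
  congr 2
  simp
  ring

lemma entireXi_two : entireXi 2 = Real.pi / 3 := by
  rw [entireXi_eq_Gammaℝ_mul (by simp), Gammaℝ_def]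
  have h := riemannZeta_eq_inv_sub_mul (s := 2) (by norm_num)
  rw [riemannZeta_two] at h
  norm_num at h
  have hπ : (Real.pi : ℂ) ≠ 0 := ofReal_ne_zero.mpr Real.pi_ne_zero
  rw [← h]
  norm_num [cpow_neg_one]
  field_simp
  norm_num

lemma norm_entireXi_div_le {z : ℂ} (hz : 0 < z.re) :
    ‖entireXi z / entireXi (z + 1)‖ ≤ 4 * (1 + ‖z - 1‖ / z.re) * (1 + 1 / z.re) := by
  have hz0 : z ≠ 0 := ne_zero_of_re_pos hz
  have hz1 : z + 1 ≠ 0 := ne_zero_of_re_pos (by simp; linarith)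
  have hζ : riemannZeta (z + 1) ≠ 0 := riemannZeta_ne_zero_of_one_le_re (by simpa using hz.le)
  have hG : Gammaℝ (z + 2 + 1) ≠ 0 := Gammaℝ_ne_zero_of_re_pos (by simp; linarith)
  have hG' : Gammaℝ (z + 1) ≠ 0 := Gammaℝ_ne_zero_of_re_pos (by simp; linarith)
  have hπ : (Real.pi : ℂ) ≠ 0 := ofReal_ne_zero.mpr Real.pi_ne_zero
  have h1 : riemannZeta₁ (z + 1) = z * riemannZeta (z + 1) := by
    rw [riemannZeta_eq_inv_sub_mul (by simpa using hz0)]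
    simp [hz0]
  have hB : Gammaℝ z * z = betaIntegral ((z + 2) / 2) (1 / 2) * Gammaℝ (z + 1) * (z + 1) := by
    have e1 := Gammaℝ_add_two hz0
    have e2 := Gammaℝ_add_two hz1
    have e3 := Gammaℝ_eq_betaIntegral_mul (z := z + 2) (by simp; linarith)
    rw [show z + 2 + 1 = z + 1 + 2 by ring, e1, e2] at e3
    field_simp at e3
    linear_combination e3
  have key : entireXi z / entireXi (z + 1) = betaIntegral ((z + 2) / 2) (1 / 2) *
      (riemannZeta₁ z / z) * (riemannZeta (z + 1))⁻¹ := by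
    rw [entireXi_eq_Gammaℝ_mul hz, entireXi_eq_Gammaℝ_mul (by simp; linarith), h1]
    field_simp
    linear_combination riemannZeta₁ z * hB
  have b1 := norm_betaIntegral_one_half_le (z := (z + 2) / 2) (by simp; linarith)
  have b2 : ‖riemannZeta₁ z / z‖ ≤ 1 + ‖z - 1‖ / z.re := by
    rw [norm_div, div_le_iff₀ (norm_pos_iff.mpr hz0), mul_comm]
    exact norm_riemannZeta₁_le hz
  have b3 : ‖(riemannZeta (z + 1))⁻¹‖ ≤ 2 * (1 + 1 / z.re) := by
    refine (norm_inv_riemannZeta_le (by simpa using hz)).trans_eq ?_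
    simp
    field_simp
  rw [key, norm_mul, norm_mul]
  calc _ ≤ 2 * (1 + ‖z - 1‖ / z.re) * (2 * (1 + 1 / z.re)) := by gcongr
    _ = _ := by ring

/-- A Phragmén–Lindelöf principle on the right half-plane, where the growth bound
is allowed to degenerate at the imaginary axis. -/
lemma norm_le_of_norm_le_imaginary_axis {f : ℂ → ℂ} {A C : ℝ}
    (hd : DiffContOnCl ℂ f {z | 0 < z.re}) (hA : 0 ≤ A)
    (hgrowth : ∀ z : ℂ, 0 < z.re → ‖f z‖ ≤ A * (1 + ‖z‖) * (1 + 1 / z.re) ^ 2)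
    (hre : IsBoundedUnder (· ≤ ·) atTop fun x : ℝ ↦ ‖f x‖)
    (him : ∀ y : ℝ, ‖f (y * I)‖ ≤ C) {z : ℂ} (hz : 0 ≤ z.re) : ‖f z‖ ≤ C := by
  have hC : 0 ≤ C := (norm_nonneg _).trans (him 0)
  have hlin : ∀ z : ℂ, 0 < z.re → ‖f z‖ ≤ (32 * A + C) * (1 + ‖z‖) := by
    intro z hz
    have hzn := norm_nonneg z
    rcases le_or_gt 1 z.re with h1 | h1
    · refine (hgrowth z hz).trans ?_
      have : (1 + 1 / z.re) ^ 2 ≤ 2 ^ 2 := by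
        gcongr
        have := (div_le_one hz).mpr h1
        linarith
      calc _ ≤ A * (1 + ‖z‖) * 2 ^ 2 := by gcongr
        _ ≤ _ := by nlinarith [mul_nonneg hA hzn, mul_nonneg hC hzn]
    set U : Set ℂ := {w | 0 < w.re} ∩ Metric.ball (z.im * I) 1 with hU
    set g : ℂ → ℂ := fun w ↦ f w * ((w - z.im * I) ^ 2 + 1) ^ 2 with hg
    have hUopen : IsOpen U :=
      (isOpen_lt continuous_const continuous_re).inter Metric.isOpen_ball
    have hgd : DiffContOnCl ℂ g U := by
      have h2 : DiffContOnCl ℂ (fun w : ℂ ↦ ((w - z.im * I) ^ 2 + 1) ^ 2) U :=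
        Differentiable.diffContOnCl (by fun_prop)
      simpa [hg, smul_eq_mul] using! (hd.mono inter_subset_left).smul h2
    have hfr : ∀ w ∈ frontier U, ‖g w‖ ≤ 16 * A * (2 + ‖z‖) + C := by
      intro w hw
      rw [hUopen.frontier_eq] at hw
      have hw1 : 0 ≤ w.re := by
        have := closure_mono inter_subset_left hw.1
        rwa [closure_setOfPred_lt_re] at this
      have hw2 : ‖w - z.im * I‖ ≤ 1 := by
        have := Metric.closure_ball_subset_closedBall (closure_mono inter_subset_right hw.1)
        rwa [Metric.mem_closedBall, dist_eq_norm] at this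
      have hpos : 0 ≤ 16 * A * (2 + ‖z‖) := by positivity
      rcases hw1.eq_or_lt with hw0 | hw0
      · have hwI : w = w.im * I := by apply Complex.ext <;> simp [← hw0]
        have hle : ‖(w - z.im * I) ^ 2 + 1‖ ≤ 1 := by
          have e : w - z.im * I = ((w.im - z.im : ℝ) : ℂ) * I := by
            rw [hwI]; simp; ring
          rw [e, norm_mul, norm_I, mul_one, norm_real, Real.norm_eq_abs] at hw2
          have e2 : (w - z.im * I) ^ 2 + 1 = ((1 - (w.im - z.im) ^ 2 : ℝ) : ℂ) := by
            rw [e, mul_pow, I_sq]; push_cast; ring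
          rw [e2, norm_real, Real.norm_eq_abs, abs_le]
          have := (sq_le_one_iff_abs_le_one _).mpr hw2
          constructor <;> nlinarith [sq_nonneg (w.im - z.im)]
        have hf : ‖f w‖ ≤ C := by rw [hwI]; exact him _
        calc ‖g w‖ = ‖f w‖ * ‖(w - z.im * I) ^ 2 + 1‖ ^ 2 := by rw [hg, norm_mul, norm_pow]
          _ ≤ C * 1 ^ 2 := by gcongr
          _ ≤ _ := by linarith
      · have hw3 : ‖w - z.im * I‖ = 1 := by
          refine hw2.antisymm (not_lt.mp fun hlt ↦ hw.2 ⟨hw0, ?_⟩)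
          rwa [Metric.mem_ball, dist_eq_norm]
        have hvre : (w - z.im * I).re = w.re := by simp
        have hh : ‖(w - z.im * I) ^ 2 + 1‖ = 2 * w.re := by
          have e : (w - z.im * I) ^ 2 + 1 = (w - z.im * I) * ((2 * w.re : ℝ) : ℂ) := by
            have e1 : (1 : ℂ) = (w - z.im * I) * starRingEnd ℂ (w - z.im * I) := by
              rw [mul_conj, normSq_eq_norm_sq, hw3]; simp
            rw [← hvre, ← add_conj, mul_add, ← e1]
            ring
          rw [e, norm_mul, hw3, norm_real, Real.norm_of_nonneg (by linarith), one_mul]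
        have hwre : w.re ≤ 1 := by
          rw [← hvre, ← hw3]; exact re_le_norm _
        have hwn : ‖w‖ ≤ 1 + ‖z‖ := by
          have e : w = (w - z.im * I) + z.im * I := by ring
          rw [e]
          refine (norm_add_le _ _).trans ?_
          rw [hw3, norm_mul, norm_I, mul_one, norm_real]
          gcongr
          exact abs_im_le_norm z
        calc ‖g w‖ = ‖f w‖ * ‖(w - z.im * I) ^ 2 + 1‖ ^ 2 := by rw [hg, norm_mul, norm_pow]
          _ ≤ (A * (1 + ‖w‖) * (1 + 1 / w.re) ^ 2) * (2 * w.re) ^ 2 := by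
            rw [hh]; gcongr; exact hgrowth w hw0
          _ = 4 * A * (1 + ‖w‖) * (w.re + 1) ^ 2 := by field_simp; ring
          _ ≤ 4 * A * (1 + (1 + ‖z‖)) * (1 + 1) ^ 2 := by gcongr
          _ ≤ _ := by linarith
    have hzv : z - z.im * I = (z.re : ℂ) := by
      apply Complex.ext <;> simp
    have hzU : z ∈ U := by
      refine ⟨hz, ?_⟩
      rwa [Metric.mem_ball, dist_eq_norm, hzv, norm_real, Real.norm_of_nonneg hz.le]
    have hgz := norm_le_of_forall_mem_frontier_norm_le
      (Metric.isBounded_ball.subset inter_subset_right) hgd hfr (subset_closure hzU)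
    have hh : 1 ≤ ‖(z - z.im * I) ^ 2 + 1‖ := by
      rw [hzv, ← ofReal_pow, ← ofReal_one, ← ofReal_add, norm_real,
        Real.norm_of_nonneg (by positivity)]
      nlinarith [sq_nonneg z.re]
    calc ‖f z‖ ≤ ‖f z‖ * ‖(z - z.im * I) ^ 2 + 1‖ ^ 2 :=
          le_mul_of_one_le_right (norm_nonneg _) (one_le_pow₀ hh)
      _ = ‖g z‖ := by rw [hg, norm_mul, norm_pow]
      _ ≤ _ := hgz
      _ ≤ _ := by nlinarith [mul_nonneg hA hzn, mul_nonneg hC hzn]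
  refine PhragmenLindelof.right_half_plane_of_bounded_on_real hd
    ⟨1, one_lt_two, 1, Asymptotics.IsBigO.of_bound (32 * A + C) ?_⟩ hre him hz
  filter_upwards [mem_inf_of_right (mem_principal_self _)] with w hw
  refine (hlin w hw).trans ?_
  rw [Real.norm_eq_abs, Real.abs_exp, Real.rpow_one, one_mul]
  gcongr
  rw [add_comm]
  exact Real.add_one_le_exp _

lemma diffContOnCl_entireXi_div :
    DiffContOnCl ℂ (fun z ↦ entireXi z / entireXi (z + 1)) {z | 0 < z.re} := by
  refine DifferentiableOn.diffContOnCl fun z hz ↦ ?_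
  rw [closure_setOfPred_lt_re] at hz
  have hne : entireXi (z + 1) ≠ 0 := entireXi_ne_zero (by simpa using hz)
  have h := differentiable_entireXi
  have h' : Differentiable ℂ fun z ↦ entireXi (z + 1) := h.comp (by fun_prop)
  exact ((h z).div (h' z) hne).differentiableWithinAt

lemma norm_entireXi_div_le_one {z : ℂ} (hz : 0 ≤ z.re) :
    ‖entireXi z / entireXi (z + 1)‖ ≤ 1 := by
  refine norm_le_of_norm_le_imaginary_axis (A := 8) diffContOnCl_entireXi_div (by norm_num)
    (fun w hw ↦ ?_) ?_ (fun y ↦ ?_) hz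
  · refine (norm_entireXi_div_le hw).trans ?_
    have hx : 0 < 1 / w.re := by positivity
    have hn : ‖w - 1‖ ≤ ‖w‖ + 1 := by simpa using norm_sub_le w 1
    have hwn := norm_nonneg w
    calc 4 * (1 + ‖w - 1‖ / w.re) * (1 + 1 / w.re)
        ≤ 4 * ((2 + 2 * ‖w‖) * (1 + 1 / w.re)) * (1 + 1 / w.re) := by
          gcongr
          rw [div_eq_mul_one_div]
          nlinarith [mul_nonneg hwn hx.le, mul_le_mul_of_nonneg_right hn hx.le]
      _ = _ := by ring
  · refine ⟨16, ?_⟩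
    rw [eventually_map]
    filter_upwards [eventually_ge_atTop 1] with x hx
    have hx0 : 0 < x := by linarith
    refine (norm_entireXi_div_le (by simpa using hx0)).trans ?_
    rw [← ofReal_one, ← ofReal_sub, norm_real, Real.norm_of_nonneg (by linarith), ofReal_re]
    have h1 : (x - 1) / x ≤ 1 := (div_le_one hx0).mpr (by linarith)
    have h2 : 1 / x ≤ 1 := (div_le_one hx0).mpr hx
    calc _ ≤ 4 * (1 + 1) * (1 + (1 : ℝ)) := by gcongr
      _ = 16 := by norm_num
  · have hne : entireXi (y * I + 1) ≠ 0 := entireXi_ne_zero (by simp)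
    rw [norm_div, norm_entireXi_add_one_of_re_eq_zero, div_self]
    rw [← norm_entireXi_add_one_of_re_eq_zero]
    exact norm_ne_zero_iff.mpr hne

lemma entireXi_ne_entireXi_add_one {z : ℂ} (hz : 0 < z.re) : entireXi z ≠ entireXi (z + 1) := by
  intro h
  have hz1 : entireXi z / entireXi (z + 1) = 1 := by
    rw [h, div_self (entireXi_ne_zero (by simpa using hz.le))]
  have hmax : IsMaxOn (norm ∘ fun z ↦ entireXi z / entireXi (z + 1)) {z | 0 < z.re} z := by
    intro w hw
    simpa [hz1] using norm_entireXi_div_le_one (le_of_lt hw)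
  have hconst := norm_eqOn_of_isPreconnected_of_isMaxOn (convex_halfSpace_re_gt 0).isPreconnected
    (isOpen_lt continuous_const continuous_re) diffContOnCl_entireXi_div.differentiableOn hz hmax
    (show (1 : ℂ) ∈ {z : ℂ | 0 < z.re} by simp)
  simp only [Function.comp_apply, Function.const_apply, hz1, one_add_one_eq_two, entireXi_one,
    entireXi_two, norm_one, norm_div, norm_real, Real.norm_of_nonneg Real.pi_pos.le] at hconst
  have := Real.pi_gt_three
  rw [one_div_div, div_eq_one_iff_eq Real.pi_pos.ne'] at hconst
  norm_num at hconst
  linarith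

/-- The Riemann Hypothesis for the rank two zeta (Lagarias–Suzuki):
every zero lies on the central line `Re s = 1/2`. -/
theorem xiQ2_riemann_hypothesis (s : ℂ) (hs : s ∉ ({0, 1/2, 1} : Set ℂ))
    (hzero : xiQ2 s = 0) : s.re = 1/2 := by
  simp only [Set.mem_insert_iff, Set.mem_singleton_iff, not_or] at hs
  obtain ⟨h0, h2, h1⟩ := hs
  have h1' : s - 1 ≠ 0 := sub_ne_zero.mpr h1
  have hXi : entireXi (2 * s) = entireXi (2 * s - 1) := by
    rw [xiQ2] at hzero
    field_simp at hzero
    rw [entireXi_eq (by grind) (by grind), entireXi_eq (by grind) (by grind)]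
    linear_combination 2 * (2 * s - 1) * hzero
  rcases lt_trichotomy s.re (1 / 2) with hlt | heq | hgt
  · refine absurd ?_ (entireXi_ne_entireXi_add_one (z := 1 - 2 * s) (by simp; linarith))
    rw [entireXi_one_sub, hXi, ← entireXi_one_sub (2 * s - 1)]
    ring_nf
  · exact heq
  · refine absurd ?_ (entireXi_ne_entireXi_add_one (z := 2 * s - 1) (by simp; linarith))
    rw [sub_add_cancel, hXi]
end

section
/- There exists an entire function h : ℂ → ℂ such that h(s) = s·(s−1)·(ξ(2s)/(s−1) − ξ(2s−1)/s) for all complex s with s ∉ {0, 1/2, 1}. In particular the rank two zeta ξ_{ℚ,2}(s) = ξ(2s)/(s−1) − ξ(2s−1)/s extends meromorphically to all of ℂ with at most simple poles, located only at s = 0 and s = 1; its apparent singularity at s = 1/2 is removable. -/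
open Complex

/-- Singularity structure of the rank two zeta (Fact C(3)): `s(s−1)·ξ_{ℚ,2}(s)` extends
to an entire function, so `ξ_{ℚ,2}` has at most simple poles, only at `s = 0` and `s = 1`,
and the apparent singularity at `s = 1/2` is removable. -/
theorem xiQ2_entire_multiple :
    ∃ h : ℂ → ℂ, Differentiable ℂ h ∧
      ∀ s : ℂ, s ∉ ({0, 1/2, 1} : Set ℂ) → h s = s * (s - 1) * xiQ2 s := by
  refine ⟨fun s => s * completedRiemannZeta₀ (2 * s) - (s - 1) * completedRiemannZeta₀ (2 * s - 1),
    ?_, fun s hs => ?_⟩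
  · have h₀ := differentiable_completedZeta₀
    fun_prop
  · simp only [Set.mem_insert_iff, Set.mem_singleton_iff, not_or] at hs
    obtain ⟨h0, h2, h1⟩ := hs
    have hs1 : s - 1 ≠ 0 := sub_ne_zero.mpr h1
    have hd : s * 2 - 1 ≠ 0 := fun h => h2 (by linear_combination h / 2)
    have e1 : 1 - 2 * s = -(s * 2 - 1) := by ring
    have e2 : 1 - (2 * s - 1) = -(2 * (s - 1)) := by ring
    simp only [xiQ2, completedRiemannZeta_eq, e1, e2]
    generalize completedRiemannZeta₀ (2 * s) = a, completedRiemannZeta₀ (2 * s - 1) = b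
    rw [mul_comm 2 s]
    field_simp
    ring
end

section
/- Let F(s) = ξ(2)·ξ(3s)/(3s−3) − ξ(2)·ξ(3s−2)/(3s) + (1/3)·ξ(3s−1)/(3s−3) − (1/3)·ξ(3s−1)/(3s) + (1/2)·ξ(3s−2)/(3s−1) − (1/2)·ξ(3s)/(3s−2). Then for every complex s with s ∉ {0, 1/3, 2/3, 1}, one has F(1−s) = F(s). -/
open Complex

local notation "ξ" => completedRiemannZeta

/-- Weng's zeta function `ξ_ℚ^{SL(3)/P}(s)` for `SL(3)` and either maximal parabolic. -/
noncomputable def wengSL3 (s : ℂ) : ℂ :=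
  ξ 2 * ξ (3*s) / (3*s - 3) - ξ 2 * ξ (3*s - 2) / (3*s)
    + (1/3) * ξ (3*s - 1) / (3*s - 3) - (1/3) * ξ (3*s - 1) / (3*s)
    + (1/2) * ξ (3*s - 2) / (3*s - 1) - (1/2) * ξ (3*s) / (3*s - 2)

/-- Functional equation for Weng's `SL(3)` zeta. -/
theorem wengSL3_functional_equation (s : ℂ) (hs : s ∉ ({0, 1/3, 2/3, 1} : Set ℂ)) :
    wengSL3 (1 - s) = wengSL3 s := by
  have h₀ : ξ (3 * (1 - s)) = ξ (3 * s - 2) := by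
    rw [← completedRiemannZeta_one_sub]; congr 1; ring
  have h₁ : ξ (3 * (1 - s) - 1) = ξ (3 * s - 1) := by
    rw [← completedRiemannZeta_one_sub]; congr 1; ring
  have h₂ : ξ (3 * (1 - s) - 2) = ξ (3 * s) := by
    rw [← completedRiemannZeta_one_sub]; congr 1; ring
  have d₀ : 3 * (1 - s) = -(3 * s - 3) := by ring
  have d₁ : 3 * (1 - s) - 1 = -(3 * s - 2) := by ring
  have d₂ : 3 * (1 - s) - 2 = -(3 * s - 1) := by ring
  have d₃ : 3 * (1 - s) - 3 = -(3 * s) := by ring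
  unfold wengSL3
  rw [h₀, h₁, h₂, d₃, d₂, d₁, d₀]
  simp only [div_neg]
  ring
end

section
/- Let F(s) = ξ(2)ξ(3)·ξ(4s)/(4s−4) − ξ(2)ξ(3)·ξ(4s−3)/(4s) + (1/4)·ξ(4s)/(4s−2) − (1/4)·ξ(4s−3)/(4s−2) + (1/3)ξ(2)·(1/(4s−1) + 1/(4s−2))·ξ(4s−3) − (1/3)ξ(2)·(1/(4s−2) + 1/(4s−3))·ξ(4s) + (1/2)·ξ(4s−1)/((4s)(4s−3)) + (1/2)·ξ(4s−2)/((4s−1)(4s−4)) − ξ(2)·ξ(4s−1)/((4s)(4s−4)) − ξ(2)·ξ(4s−2)/((4s)(4s−4)). Then for every complex s with s ∉ {0, 1/4, 1/2, 3/4, 1}, one has F(1−s) = F(s). -/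
open Complex

local notation "ξ" => completedRiemannZeta

/-- Weng's zeta function `ξ_ℚ^{SL(4)/P_{3,1}}(s) = ξ_ℚ^{SL(4)/P_{1,3}}(s)`. -/
noncomputable def wengSL4P31 (s : ℂ) : ℂ :=
  ξ 2 * ξ 3 * ξ (4*s) / (4*s - 4) - ξ 2 * ξ 3 * ξ (4*s - 3) / (4*s)
    + (1/4) * ξ (4*s) / (4*s - 2) - (1/4) * ξ (4*s - 3) / (4*s - 2)
    + (1/3) * ξ 2 * (1/(4*s - 1) + 1/(4*s - 2)) * ξ (4*s - 3)
    - (1/3) * ξ 2 * (1/(4*s - 2) + 1/(4*s - 3)) * ξ (4*s)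
    + (1/2) * ξ (4*s - 1) / ((4*s) * (4*s - 3))
    + (1/2) * ξ (4*s - 2) / ((4*s - 1) * (4*s - 4))
    - ξ 2 * ξ (4*s - 1) / ((4*s) * (4*s - 4))
    - ξ 2 * ξ (4*s - 2) / ((4*s) * (4*s - 4))

/-- Functional equation for Weng's zeta of `(SL(4), P_{3,1})` over `ℚ`. -/
theorem wengSL4P31_functional_equation (s : ℂ)
    (hs : s ∉ ({0, 1/4, 1/2, 3/4, 1} : Set ℂ)) :
    wengSL4P31 (1 - s) = wengSL4P31 s := by
  have h₁ : ξ (4 * (1 - s)) = ξ (4*s - 3) := by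
    rw [← completedRiemannZeta_one_sub]; ring_nf
  have h₂ : ξ (4 * (1 - s) - 3) = ξ (4*s) := by
    rw [← completedRiemannZeta_one_sub]; ring_nf
  have h₃ : ξ (4 * (1 - s) - 1) = ξ (4*s - 2) := by
    rw [← completedRiemannZeta_one_sub]; ring_nf
  have h₄ : ξ (4 * (1 - s) - 2) = ξ (4*s - 1) := by
    rw [← completedRiemannZeta_one_sub]; ring_nf
  have e₁ : 4 * (1 - s) - 4 = -(4*s) := by ring
  have e₂ : 4 * (1 - s) - 3 = -(4*s - 1) := by ring
  have e₃ : 4 * (1 - s) - 2 = -(4*s - 2) := by ring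
  have e₄ : 4 * (1 - s) - 1 = -(4*s - 3) := by ring
  have e₅ : 4 * (1 - s) = -(4*s - 4) := by ring
  unfold wengSL4P31
  rw [h₁, h₂, h₃, h₄, e₁, e₂, e₃, e₄, e₅]
  simp only [div_neg, neg_mul_neg]
  ring
end

section
/- Let G(s) = ξ(2)²·ξ(2s)ξ(2s+1)/(2s−3) − ξ(2)²·ξ(2s−2)ξ(2s−1)/(2s+1) + (1/4)·ξ(2s)ξ(2s+1)/(2s−1) − (1/4)·ξ(2s−2)ξ(2s−1)/(2s−1) + ξ(2s−1)²/((2s)²(2s−3)) − ξ(2s)²/((2s−2)²(2s+1)) − ξ(2)·ξ(2s)ξ(2s+1)/(2s−2) + ξ(2)·ξ(2s−2)ξ(2s−1)/(2s) + ξ(2s−1)ξ(2s)/((2s−2)(2s)) − 2·ξ(2)·ξ(2s−1)ξ(2s)/((2s−3)(2s+1)). Then for every complex s with s ∉ {−1/2, 0, 1/2, 1, 3/2}, one has G(1−s) = G(s). -/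
open Complex

local notation "ξ" => completedRiemannZeta

/-- Weng's zeta function `ξ_ℚ^{SL(4)/P_{2,2}}(s)` (with the misprint in the second
term of the printed formula corrected: its coefficient is `ξ(2)²`). -/
noncomputable def wengSL4P22 (s : ℂ) : ℂ :=
  ξ 2 ^ 2 * ξ (2*s) * ξ (2*s + 1) / (2*s - 3)
    - ξ 2 ^ 2 * ξ (2*s - 2) * ξ (2*s - 1) / (2*s + 1)
    + (1/4) * ξ (2*s) * ξ (2*s + 1) / (2*s - 1)
    - (1/4) * ξ (2*s - 2) * ξ (2*s - 1) / (2*s - 1)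
    + ξ (2*s - 1) ^ 2 / ((2*s)^2 * (2*s - 3))
    - ξ (2*s) ^ 2 / ((2*s - 2)^2 * (2*s + 1))
    - ξ 2 * ξ (2*s) * ξ (2*s + 1) / (2*s - 2)
    + ξ 2 * ξ (2*s - 2) * ξ (2*s - 1) / (2*s)
    + ξ (2*s - 1) * ξ (2*s) / ((2*s - 2) * (2*s))
    - 2 * ξ 2 * ξ (2*s - 1) * ξ (2*s) / ((2*s - 3) * (2*s + 1))

/-- Functional equation for Weng's zeta of `(SL(4), P_{2,2})` over `ℚ`. -/
theorem wengSL4P22_functional_equation (s : ℂ)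
    (hs : s ∉ ({-1/2, 0, 1/2, 1, 3/2} : Set ℂ)) :
    wengSL4P22 (1 - s) = wengSL4P22 s := by
  have h₁ : ξ (2*(1 - s)) = ξ (2*s - 1) := by
    rw [← completedRiemannZeta_one_sub]; congr 1; ring
  have h₂ : ξ (2*(1 - s) + 1) = ξ (2*s - 2) := by
    rw [← completedRiemannZeta_one_sub]; congr 1; ring
  have h₃ : ξ (2*(1 - s) - 2) = ξ (2*s + 1) := by
    rw [← completedRiemannZeta_one_sub]; congr 1; ring
  have h₄ : ξ (2*(1 - s) - 1) = ξ (2*s) := by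
    rw [← completedRiemannZeta_one_sub]; congr 1; ring
  have d₁ : 2*(1 - s) - 3 = -(2*s + 1) := by ring
  have d₂ : 2*(1 - s) + 1 = -(2*s - 3) := by ring
  have d₃ : 2*(1 - s) - 1 = -(2*s - 1) := by ring
  have d₄ : 2*(1 - s) - 2 = -(2*s) := by ring
  have d₅ : 2*(1 - s) = -(2*s - 2) := by ring
  simp only [wengSL4P22, h₁, h₂, h₃, h₄]
  rw [d₁, d₂, d₃, d₄, d₅]
  simp only [div_neg, neg_sq, mul_neg, neg_mul, neg_neg]
  ring
end

section
/- Let F(s) = ξ(2)ξ(3)ξ(4)·(ξ(5s)/(5s−5) − ξ(5s−4)/(5s)) + (1/4)ξ(2)ξ(3)·(ξ(5s−4)/(5s−1) − ξ(5s)/(5s−4) + ξ(5s−4)/(5s−3) − ξ(5s)/(5s−2)) + (1/9)ξ(2)·(ξ(5s)/(5s−2) − ξ(5s−4)/(5s−3)) + (1/6)ξ(2)·(ξ(5s)/(5s−3) − ξ(5s−4)/(5s−2) + ξ(5s)/(5s−2) − ξ(5s−4)/(5s−3)) + ξ(2)·((1/3)·(ξ(5s−1)/((5s)(5s−4)) +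 ξ(5s−3)/((5s−5)(5s−1))) + (1/2)·(ξ(5s−2)/((5s−1)(5s−5)) + ξ(5s−2)/((5s−4)(5s))) + (1/3)·(ξ(5s−3)/((5s−2)(5s−5)) + ξ(5s−1)/((5s−3)(5s)))) + (1/8)·(ξ(5s−4)/(5s−3) − ξ(5s)/(5s−2)) + (1/4)ξ(2)²·(ξ(5s−4)/(5s−2) − ξ(5s)/(5s−3)) − (1/4)·(ξ(5s−1)/((5s−3)(5s)) + ξ(5s−3)/((5s−2)(5s−5))) − ξ(2)ξ(3)·(ξ(5s−1)/((5s)(5s−5)) + ξ(5s−3)/((5s)(5s−5))) − (1/4)·ξ(5s−2)/((5s−1)(5s−4)) − ξ(2)²·ξ(5s−2)/((5s)(5s−5)). Then for every complex s with s ∉ {0, 1/5, 2/5, 3/5, 4/5, 1}, one has F(1−s) = F(s). -/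
open Complex

local notation "ξ" => completedRiemannZeta

/-- Weng's zeta function `ξ_{SL(5);ℚ}(s) = ξ_ℚ^{SL(5)/P_{4,1}}(s) = ξ_ℚ^{SL(5)/P_{1,4}}(s)`. -/
noncomputable def wengSL5P41 (s : ℂ) : ℂ :=
  ξ 2 * ξ 3 * ξ 4 * (ξ (5*s) / (5*s - 5) - ξ (5*s - 4) / (5*s))
    + (1/4) * ξ 2 * ξ 3 * (ξ (5*s - 4) / (5*s - 1) - ξ (5*s) / (5*s - 4)
        + ξ (5*s - 4) / (5*s - 3) - ξ (5*s) / (5*s - 2))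
    + (1/9) * ξ 2 * (ξ (5*s) / (5*s - 2) - ξ (5*s - 4) / (5*s - 3))
    + (1/6) * ξ 2 * (ξ (5*s) / (5*s - 3) - ξ (5*s - 4) / (5*s - 2)
        + ξ (5*s) / (5*s - 2) - ξ (5*s - 4) / (5*s - 3))
    + ξ 2 * ((1/3) * (ξ (5*s - 1) / ((5*s) * (5*s - 4))
          + ξ (5*s - 3) / ((5*s - 5) * (5*s - 1)))
        + (1/2) * (ξ (5*s - 2) / ((5*s - 1) * (5*s - 5))
          + ξ (5*s - 2) / ((5*s - 4) * (5*s)))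
        + (1/3) * (ξ (5*s - 3) / ((5*s - 2) * (5*s - 5))
          + ξ (5*s - 1) / ((5*s - 3) * (5*s))))
    + (1/8) * (ξ (5*s - 4) / (5*s - 3) - ξ (5*s) / (5*s - 2))
    + (1/4) * ξ 2 ^ 2 * (ξ (5*s - 4) / (5*s - 2) - ξ (5*s) / (5*s - 3))
    - (1/4) * (ξ (5*s - 1) / ((5*s - 3) * (5*s))
        + ξ (5*s - 3) / ((5*s - 2) * (5*s - 5)))
    - ξ 2 * ξ 3 * (ξ (5*s - 1) / ((5*s) * (5*s - 5))
        + ξ (5*s - 3) / ((5*s) * (5*s - 5)))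
    - (1/4) * ξ (5*s - 2) / ((5*s - 1) * (5*s - 4))
    - ξ 2 ^ 2 * ξ (5*s - 2) / ((5*s) * (5*s - 5))

/-- Functional equation for Weng's zeta of `(SL(5), P_{4,1})` over `ℚ`. -/
theorem wengSL5P41_functional_equation (s : ℂ)
    (hs : s ∉ ({0, 1/5, 2/5, 3/5, 4/5, 1} : Set ℂ)) :
    wengSL5P41 (1 - s) = wengSL5P41 s := by
  have h0 : ξ (5 - 5*s) = ξ (5*s - 4) := by
    rw [← completedRiemannZeta_one_sub]; congr 1; ring
  have h1 : ξ (5 - 5*s - 1) = ξ (5*s - 3) := by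
    rw [← completedRiemannZeta_one_sub]; congr 1; ring
  have h2 : ξ (5 - 5*s - 2) = ξ (5*s - 2) := by
    rw [← completedRiemannZeta_one_sub]; congr 1; ring
  have h3 : ξ (5 - 5*s - 3) = ξ (5*s - 1) := by
    rw [← completedRiemannZeta_one_sub]; congr 1; ring
  have h4 : ξ (5 - 5*s - 4) = ξ (5*s) := by
    rw [← completedRiemannZeta_one_sub]; congr 1; ring
  have e : 5 * (1 - s) = 5 - 5*s := by ring
  have d0 : 5 - 5*s = -(5*s - 5) := by ring
  have d1 : -(5*s - 5) - 1 = -(5*s - 4) := by ring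
  have d2 : -(5*s - 5) - 2 = -(5*s - 3) := by ring
  have d3 : -(5*s - 5) - 3 = -(5*s - 2) := by ring
  have d4 : -(5*s - 5) - 4 = -(5*s - 1) := by ring
  have d5 : -(5*s - 5) - 5 = -(5*s) := by ring
  unfold wengSL5P41
  rw [e, h0, h1, h2, h3, h4, d0, d1, d2, d3, d4, d5]
  simp only [div_neg, neg_mul_neg]
  ring
end

section
/- Let F(s) = ξ(2)²ξ(3)·ξ(5s+4)ξ(5s+5)/(5s) + ξ(2)·ξ(5s+4)ξ(5s+5)/(4(5s+2)) + ξ(2)·ξ(5s+2)ξ(5s+3)/((5s+4)²(5s)) − ξ(2)ξ(3)·ξ(5s+4)ξ(5s+5)/(2(5s+1)) − ξ(2)²·ξ(5s+4)ξ(5s+5)/(3(5s+1)) − ξ(2)²·ξ(5s+4)ξ(5s+5)/(3(5s+2)) − ξ(5s+3)ξ(5s+4)/(4(5s+2)(5s+4)) + ξ(2)²·ξ(5s+1)ξ(5s+2)/(3(5s+3)) − ξ(5s+2)ξ(5s+3)/(2(5s+1)(5s+3)(5s+4)) + ξ(5s+1)ξ(5s+2)/(8(5s+2)) − ξ(2)·ξ(5s+3)ξ(5s+4)/((5s+1)²(5s+5))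 − ξ(2)·ξ(5s+1)ξ(5s+2)/(6(5s+3)) − ξ(5s+2)²/(2(5s)(5s+3)²) − ξ(5s+2)ξ(5s+4)/(4(5s+2)(5s+3)) + ξ(2)ξ(3)·ξ(5s+1)ξ(5s+2)/(2(5s+4)) + ξ(2)·ξ(5s+2)ξ(5s+3)/(2(5s)(5s+4)) + ξ(2)·ξ(5s+2)ξ(5s+3)/(2(5s+1)(5s+4)) + ξ(2)·ξ(5s+4)ξ(5s+5)/(6(5s+2)) + ξ(2)·ξ(5s+4)ξ(5s+5)/(6(5s+3)) + ξ(2)·ξ(5s+3)ξ(5s+4)/(2(5s+1)(5s+4)) + ξ(5s+3)²/((5s+1)²(5s+4)²) + ξ(2)·ξ(5s+2)ξ(5s+4)/(3(5s+2)(5s+4)) − ξ(5s+4)ξ(5s+5)/(8(5s+3)) − ξ(2)·ξ(5s+1)ξ(5s+2)/(6(5s+2)) − ξ(2)·ξ(5s+1)ξ(5s+2)/(4(5s+3)) + ξ(2)·ξ(5s+3)ξ(5s+4)/(2(5s+1)(5s+5)) + ξ(5s+4)²/(2(5s+2)²(5s+5)) − ξ(2)ξ(3)·ξ(5s+2)ξ(5s+4)/((5s)(5s+5))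 − ξ(2)²·ξ(5s+3)ξ(5s+4)/((5s)(5s+5)) − ξ(2)·ξ(5s+4)²/((5s+1)(5s+2)(5s+5)) + ξ(2)·ξ(5s+2)ξ(5s+4)/(3(5s+1)(5s+3)) + ξ(5s+3)ξ(5s+4)/(2(5s+1)(5s+2)(5s+4)) − ξ(5s+2)ξ(5s+3)/(4(5s+1)(5s+3)) − ξ(2)²ξ(3)·ξ(5s+1)ξ(5s+2)/(5s+5) − ξ(2)²·ξ(5s+2)ξ(5s+3)/((5s)(5s+5)) + ξ(2)·ξ(5s+2)²/((5s)(5s+3)(5s+4)) + ξ(2)²·ξ(5s+1)ξ(5s+2)/(3(5s+4)). Then for every complex s with s ∉ {−1, −4/5, −3/5, −2/5, −1/5, 0}, one has F(−1−s) = F(s); equivalently, the normalized zeta ξ_ℚ^{SL(5)/P_{3,2}}(s) := F(s−1) satisfies ξ_ℚ^{SL(5)/P_{3,2}}(1−s) = ξ_ℚ^{SL(5)/P_{3,2}}(s). -/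
open Complex

local notation "ξ" => completedRiemannZeta

/-- The (not yet shifted) Weng zeta `ξ_{ℚ;o}^{SL(5)/P_{3,2}}(s) = ξ_{ℚ;o}^{SL(5)/P_{2,3}}(s)`
attached to `SL(5)` and the maximal parabolic of type `(3,2)`. -/
noncomputable def wengSL5P32o (s : ℂ) : ℂ :=
  ξ 2 ^ 2 * ξ 3 * ξ (5*s + 4) * ξ (5*s + 5) / (5*s)
    + ξ 2 * ξ (5*s + 4) * ξ (5*s + 5) / (4 * (5*s + 2))
    + ξ 2 * ξ (5*s + 2) * ξ (5*s + 3) / ((5*s + 4)^2 * (5*s))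
    - ξ 2 * ξ 3 * ξ (5*s + 4) * ξ (5*s + 5) / (2 * (5*s + 1))
    - ξ 2 ^ 2 * ξ (5*s + 4) * ξ (5*s + 5) / (3 * (5*s + 1))
    - ξ 2 ^ 2 * ξ (5*s + 4) * ξ (5*s + 5) / (3 * (5*s + 2))
    - ξ (5*s + 3) * ξ (5*s + 4) / (4 * (5*s + 2) * (5*s + 4))
    + ξ 2 ^ 2 * ξ (5*s + 1) * ξ (5*s + 2) / (3 * (5*s + 3))
    - ξ (5*s + 2) * ξ (5*s + 3) / (2 * (5*s + 1) * (5*s + 3) * (5*s + 4))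
    + ξ (5*s + 1) * ξ (5*s + 2) / (8 * (5*s + 2))
    - ξ 2 * ξ (5*s + 3) * ξ (5*s + 4) / ((5*s + 1)^2 * (5*s + 5))
    - ξ 2 * ξ (5*s + 1) * ξ (5*s + 2) / (6 * (5*s + 3))
    - ξ (5*s + 2) ^ 2 / (2 * (5*s) * (5*s + 3)^2)
    - ξ (5*s + 2) * ξ (5*s + 4) / (4 * (5*s + 2) * (5*s + 3))
    + ξ 2 * ξ 3 * ξ (5*s + 1) * ξ (5*s + 2) / (2 * (5*s + 4))
    + ξ 2 * ξ (5*s + 2) * ξ (5*s + 3) / (2 * (5*s) * (5*s + 4))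
    + ξ 2 * ξ (5*s + 2) * ξ (5*s + 3) / (2 * (5*s + 1) * (5*s + 4))
    + ξ 2 * ξ (5*s + 4) * ξ (5*s + 5) / (6 * (5*s + 2))
    + ξ 2 * ξ (5*s + 4) * ξ (5*s + 5) / (6 * (5*s + 3))
    + ξ 2 * ξ (5*s + 3) * ξ (5*s + 4) / (2 * (5*s + 1) * (5*s + 4))
    + ξ (5*s + 3) ^ 2 / ((5*s + 1)^2 * (5*s + 4)^2)
    + ξ 2 * ξ (5*s + 2) * ξ (5*s + 4) / (3 * (5*s + 2) * (5*s + 4))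
    - ξ (5*s + 4) * ξ (5*s + 5) / (8 * (5*s + 3))
    - ξ 2 * ξ (5*s + 1) * ξ (5*s + 2) / (6 * (5*s + 2))
    - ξ 2 * ξ (5*s + 1) * ξ (5*s + 2) / (4 * (5*s + 3))
    + ξ 2 * ξ (5*s + 3) * ξ (5*s + 4) / (2 * (5*s + 1) * (5*s + 5))
    + ξ (5*s + 4) ^ 2 / (2 * (5*s + 2)^2 * (5*s + 5))
    - ξ 2 * ξ 3 * ξ (5*s + 2) * ξ (5*s + 4) / ((5*s) * (5*s + 5))
    - ξ 2 ^ 2 * ξ (5*s + 3) * ξ (5*s + 4) / ((5*s) * (5*s + 5))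
    - ξ 2 * ξ (5*s + 4) ^ 2 / ((5*s + 1) * (5*s + 2) * (5*s + 5))
    + ξ 2 * ξ (5*s + 2) * ξ (5*s + 4) / (3 * (5*s + 1) * (5*s + 3))
    + ξ (5*s + 3) * ξ (5*s + 4) / (2 * (5*s + 1) * (5*s + 2) * (5*s + 4))
    - ξ (5*s + 2) * ξ (5*s + 3) / (4 * (5*s + 1) * (5*s + 3))
    - ξ 2 ^ 2 * ξ 3 * ξ (5*s + 1) * ξ (5*s + 2) / (5*s + 5)
    - ξ 2 ^ 2 * ξ (5*s + 2) * ξ (5*s + 3) / ((5*s) * (5*s + 5))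
    + ξ 2 * ξ (5*s + 2) ^ 2 / ((5*s) * (5*s + 3) * (5*s + 4))
    + ξ 2 ^ 2 * ξ (5*s + 1) * ξ (5*s + 2) / (3 * (5*s + 4))

/-- Functional equation for the zeta of `(SL(5), P_{3,2})` over `ℚ`:
`F(−1−s) = F(s)`; equivalently the normalized zeta `s ↦ F(s−1)` is symmetric
under `s ↔ 1−s`. -/
theorem wengSL5P32o_functional_equation (s : ℂ)
    (hs : s ∉ ({-1, -4/5, -3/5, -2/5, -1/5, 0} : Set ℂ)) :
    wengSL5P32o (-1 - s) = wengSL5P32o s := by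
  have reflect {a b : ℂ} (h : a = 1 - b) : ξ a = ξ b := by
    rw [h, completedRiemannZeta_one_sub]
  have hξ₁ : ξ (5*(-1 - s) + 1) = ξ (5*s + 5) := reflect (by ring)
  have hξ₂ : ξ (5*(-1 - s) + 2) = ξ (5*s + 4) := reflect (by ring)
  have hξ₃ : ξ (5*(-1 - s) + 3) = ξ (5*s + 3) := reflect (by ring)
  have hξ₄ : ξ (5*(-1 - s) + 4) = ξ (5*s + 2) := reflect (by ring)
  have hξ₅ : ξ (5*(-1 - s) + 5) = ξ (5*s + 1) := reflect (by ring)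
  unfold wengSL5P32o
  rw [hξ₁, hξ₂, hξ₃, hξ₄, hξ₅]
  have h₁ : 5*(-1 - s) + 1 = -(5*s + 4) := by ring
  have h₂ : 5*(-1 - s) + 2 = -(5*s + 3) := by ring
  have h₃ : 5*(-1 - s) + 3 = -(5*s + 2) := by ring
  have h₄ : 5*(-1 - s) + 4 = -(5*s + 1) := by ring
  have h₅ : 5*(-1 - s) + 5 = -(5*s) := by ring
  have h₀ : 5*(-1 - s) = -(5*s + 5) := by ring
  rw [h₁, h₂, h₃, h₄, h₅, h₀]
  -- As atoms, the shifted denominators have inverses that `ring` can compare up to sign.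
  generalize 5*s + 1 = d₁
  generalize 5*s + 2 = d₂
  generalize 5*s + 3 = d₃
  generalize 5*s + 4 = d₄
  generalize 5*s + 5 = d₅
  generalize 5*s = d₀
  ring
end

section
/- Let F(s) = ξ(2)·ξ(s+1)ξ(2s)/(s−2) − ξ(2)·ξ(s−1)ξ(2s−1)/(s+1) − ξ(s+1)ξ(2s)/(2s−2) + ξ(s−1)ξ(2s−1)/(2s) − ξ(s)ξ(2s)/((2s−2)(s+1)) − ξ(s)ξ(2s−1)/((2s)(s−2)). Then for every complex s with s ∉ {−1, 0, 1/2, 1, 2}, one has F(1−s) = F(s). -/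
open Complex

local notation "ξ" => completedRiemannZeta

/-- Weng's zeta function `ξ_ℚ^{Sp(4)/P_{e₁−e₂}}(s)`. -/
noncomputable def wengSp4P1 (s : ℂ) : ℂ :=
  ξ 2 * ξ (s + 1) * ξ (2*s) / (s - 2)
    - ξ 2 * ξ (s - 1) * ξ (2*s - 1) / (s + 1)
    - ξ (s + 1) * ξ (2*s) / (2*s - 2)
    + ξ (s - 1) * ξ (2*s - 1) / (2*s)
    - ξ s * ξ (2*s) / ((2*s - 2) * (s + 1))
    - ξ s * ξ (2*s - 1) / ((2*s) * (s - 2))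

/-- Functional equation for Weng's zeta of `(Sp(4), P_{e₁−e₂})` over `ℚ`. -/
theorem wengSp4P1_functional_equation (s : ℂ)
    (hs : s ∉ ({-1, 0, 1/2, 1, 2} : Set ℂ)) :
    wengSp4P1 (1 - s) = wengSp4P1 s := by
  have h₁ : ξ (1 - s + 1) = ξ (s - 1) := by
    rw [← completedRiemannZeta_one_sub (s - 1)]; congr 1; ring
  have h₂ : ξ (2 * (1 - s)) = ξ (2 * s - 1) := by
    rw [← completedRiemannZeta_one_sub (2 * s - 1)]; congr 1; ring
  have h₃ : ξ (1 - s - 1) = ξ (s + 1) := by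
    rw [← completedRiemannZeta_one_sub (s + 1)]; congr 1; ring
  have h₄ : ξ (2 * (1 - s) - 1) = ξ (2 * s) := by
    rw [← completedRiemannZeta_one_sub (2 * s)]; congr 1; ring
  have d₁ : 1 - s - 2 = -(s + 1) := by ring
  have d₂ : 1 - s + 1 = -(s - 2) := by ring
  have d₃ : 2 * (1 - s) - 2 = -(2 * s) := by ring
  have d₄ : 2 * (1 - s) = -(2 * s - 2) := by ring
  unfold wengSp4P1
  rw [h₁, h₂, h₃, h₄, completedRiemannZeta_one_sub s, d₁, d₂, d₃, d₄]
  simp only [div_neg, neg_mul_neg]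
  ring
end

section
/- Let F(s) = ξ(2)·ξ(2s+1)/(2s−3) − ξ(2)·ξ(2s−2)/(2s+1) − ξ(2s+1)/(2(2s−1)) + ξ(2s−2)/(2(2s−1)) − ξ(2s)/((2s+1)(2s−2)) − ξ(2s−1)/((2s)(2s−3)). Then for every complex s with s ∉ {−1/2, 0, 1/2, 1, 3/2}, one has F(1−s) = F(s). -/
open Complex

local notation "ξ" => completedRiemannZeta

/-- Weng's zeta function `ξ_ℚ^{Sp(4)/P_{2e₂}}(s)`. -/
noncomputable def wengSp4P2 (s : ℂ) : ℂ :=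
  ξ 2 * ξ (2*s + 1) / (2*s - 3)
    - ξ 2 * ξ (2*s - 2) / (2*s + 1)
    - ξ (2*s + 1) / (2 * (2*s - 1))
    + ξ (2*s - 2) / (2 * (2*s - 1))
    - ξ (2*s) / ((2*s + 1) * (2*s - 2))
    - ξ (2*s - 1) / ((2*s) * (2*s - 3))

/-- Functional equation for Weng's zeta of `(Sp(4), P_{2e₂})` over `ℚ`. -/
theorem wengSp4P2_functional_equation (s : ℂ)
    (hs : s ∉ ({-1/2, 0, 1/2, 1, 3/2} : Set ℂ)) :
    wengSp4P2 (1 - s) = wengSp4P2 s := by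
  have h₁ : ξ (2 * (1 - s) + 1) = ξ (2 * s - 2) := by
    rw [← completedRiemannZeta_one_sub]; ring_nf
  have h₂ : ξ (2 * (1 - s) - 2) = ξ (2 * s + 1) := by
    rw [← completedRiemannZeta_one_sub]; ring_nf
  have h₃ : ξ (2 * (1 - s)) = ξ (2 * s - 1) := by
    rw [← completedRiemannZeta_one_sub]; ring_nf
  have h₄ : ξ (2 * (1 - s) - 1) = ξ (2 * s) := by
    rw [← completedRiemannZeta_one_sub]; ring_nf
  have e₁ : 2 * (1 - s) - 3 = -(2 * s + 1) := by ring
  have e₂ : 2 * (1 - s) + 1 = -(2 * s - 3) := by ring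
  have e₃ : 2 * (1 - s) - 1 = -(2 * s - 1) := by ring
  have e₄ : 2 * (1 - s) - 2 = -(2 * s) := by ring
  have e₅ : 2 * (1 - s) = -(2 * s - 2) := by ring
  unfold wengSp4P2
  rw [h₁, h₂, h₃, h₄, e₁, e₂, e₃, e₄, e₅]
  simp only [mul_neg, neg_mul, neg_neg, div_neg]
  rw [mul_comm (2 * s - 3) (2 * s), mul_comm (2 * s - 2) (2 * s + 1)]
  ring
end
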